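/- There exists a universal constant C′ > 0 such that the following holds. Let N, M > 0 with M ≤ N/4000, and let (ν,k), (ζ,m), (ξ,n) ∈ ℝ×ℤ with ν+ζ+ξ = 0, k+m+n = 0, N ≤ |(ν,k)|, |(ζ,m)|, |(ξ,n)| ≤ 8N, |θᵢ − θⱼ| ≤ 2M for all i, j ∈ {1,2,3}, and min{|ν|,|ζ|,|ξ|} ≤ 2¹⁴·M. Then, after some permutation of the three pairs (ν,k), (ζ,m), (ξ,n), one has |ν| ≤ C′M, |(ζ,m) − (−k/2, −k/2)| ≤ C′M, and |(ξ,n) − (k/2, −k/2)| ≤ C′M. -/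

import Mathlib

open Real

noncomputable section

/-- `θ(a,b) = (3a² + b²)^{1/2}`. -/
def theta (a b : ℝ) : ℝ := Real.sqrt (3 * a ^ 2 + b ^ 2)

/-- Euclidean norm of a point of `ℝ²`. -/
def nrm (x y : ℝ) : ℝ := Real.sqrt (x ^ 2 + y ^ 2)

lemma abs_fst_le_nrm (x y : ℝ) : |x| ≤ nrm x y := by
  rw [nrm, ← Real.sqrt_sq_eq_abs]
  exact Real.sqrt_le_sqrt (by nlinarith [sq_nonneg y])

lemma abs_snd_le_nrm (x y : ℝ) : |y| ≤ nrm x y := by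
  rw [nrm, ← Real.sqrt_sq_eq_abs]
  exact Real.sqrt_le_sqrt (by nlinarith [sq_nonneg x])

lemma nrm_le_abs_add_abs (x y : ℝ) : nrm x y ≤ |x| + |y| := by
  rw [nrm, Real.sqrt_le_left (by positivity)]
  nlinarith [sq_abs x, sq_abs y, mul_nonneg (abs_nonneg x) (abs_nonneg y)]

lemma theta_nonneg (a b : ℝ) : 0 ≤ theta a b := Real.sqrt_nonneg _

lemma theta_sq (a b : ℝ) : theta a b ^ 2 = 3 * a ^ 2 + b ^ 2 :=
  Real.sq_sqrt (by positivity)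

lemma theta_le_two_mul_nrm (a b : ℝ) : theta a b ≤ 2 * nrm a b := by
  refine Real.sqrt_le_iff.mpr ⟨mul_nonneg zero_le_two (Real.sqrt_nonneg _), ?_⟩
  rw [mul_pow, nrm, Real.sq_sqrt (by positivity)]
  nlinarith [sq_nonneg a, sq_nonneg b]

lemma abs_theta_sq_sub_le {N M a b c d : ℝ} (hM : 0 ≤ M)
    (hab : nrm a b ≤ 8 * N) (hcd : nrm c d ≤ 8 * N)
    (h : |theta a b - theta c d| ≤ 2 * M) :
    |(3 * a ^ 2 + b ^ 2) - (3 * c ^ 2 + d ^ 2)| ≤ 64 * (M * N) := by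
  rw [← theta_sq a b, ← theta_sq c d, sq_sub_sq, abs_mul, mul_comm]
  have hs : |theta a b + theta c d| ≤ 32 * N := by
    rw [abs_of_nonneg (add_nonneg (theta_nonneg _ _) (theta_nonneg _ _))]
    linarith [theta_le_two_mul_nrm a b, theta_le_two_mul_nrm c d]
  calc |theta a b - theta c d| * |theta a b + theta c d| ≤ (2 * M) * (32 * N) := by
        gcongr
    _ = 64 * (M * N) := by ring

lemma half_le_abs_snd {N a b : ℝ} (hab : N ≤ nrm a b) (ha : |a| ≤ N / 2) :
    N / 2 ≤ |b| := by
  linarith [nrm_le_abs_add_abs a b]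

/-- If `|r * x| ≤ c * N` and `d * N ≤ |r|`, then `|x| ≤ c / d`. -/
lemma abs_le_of_abs_mul_le {N c d r x : ℝ} (hN : 0 < N) (hd : 0 < d)
    (hr : d * N ≤ |r|) (h : |r * x| ≤ c * N) : |x| ≤ c / d := by
  rw [abs_mul] at h
  rw [le_div_iff₀ hd]
  refine le_of_mul_le_mul_right ?_ hN
  nlinarith [mul_le_mul_of_nonneg_right hr (abs_nonneg x)]

/-- Quantitative localization when the first pair has small first coordinate compared to `N`. -/
lemma localization_of_small_fst {N M ν ζ ξ k m n : ℝ} (hN : 0 < N) (hM : 0 < M)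
    (hNM : 2 ^ 15 * M ≤ N) (hν : ν + ζ + ξ = 0) (hk : k + m + n = 0)
    (h1 : N ≤ nrm ν k) (h1' : nrm ν k ≤ 8 * N) (h2' : nrm ζ m ≤ 8 * N) (h3' : nrm ξ n ≤ 8 * N)
    (h12 : |theta ν k - theta ζ m| ≤ 2 * M) (h23 : |theta ζ m - theta ξ n| ≤ 2 * M)
    (hs : |ν| ≤ 2 ^ 14 * M) :
    |m + k / 2| ≤ 10 ^ 6 * M ∧ |n + k / 2| ≤ 10 ^ 6 * M ∧
      ((|ζ + k / 2| ≤ 10 ^ 8 * M ∧ |ξ - k / 2| ≤ 10 ^ 8 * M + 2 ^ 14 * M) ∨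
       (|ξ + k / 2| ≤ 10 ^ 8 * M + 2 ^ 14 * M ∧ |ζ - k / 2| ≤ 10 ^ 8 * M)) := by
  have hkN : N / 2 ≤ |k| := half_le_abs_snd h1 (by linarith)
  have hνa := (abs_fst_le_nrm ν k).trans h1'
  have hka := (abs_snd_le_nrm ν k).trans h1'
  have hζa := (abs_fst_le_nrm ζ m).trans h2'
  have hma := (abs_snd_le_nrm ζ m).trans h2'
  have hξa := (abs_fst_le_nrm ξ n).trans h3'
  have e12 := abs_theta_sq_sub_le hM.le h1' h2' h12
  have e23 := abs_theta_sq_sub_le hM.le h2' h3' h23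
  have hζξ : |ν * (ζ - ξ)| ≤ (2 ^ 14 * M) * (16 * N) := by
    rw [abs_mul]
    gcongr
    linarith [abs_sub ζ ξ]
  have hmn : |k * (m + k / 2)| ≤ (400000 * M) * N := by
    have e : k * (m + k / 2) =
        -(((3 * ζ ^ 2 + m ^ 2) - (3 * ξ ^ 2 + n ^ 2)) + 3 * (ν * (ζ - ξ))) / 2 := by
      obtain rfl : ξ = -ν - ζ := by linarith
      obtain rfl : n = -k - m := by linarith
      ring
    rw [e]
    rw [abs_le] at *
    constructor <;> linarith [mul_pos hM hN]
  have hm : |m + k / 2| ≤ 10 ^ 6 * M :=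
    (abs_le_of_abs_mul_le hN one_half_pos (by linarith) hmn).trans (by linarith)
  have hn : |n + k / 2| ≤ 10 ^ 6 * M := by
    rwa [show n + k / 2 = -(m + k / 2) by linarith, abs_neg]
  have hm2 : |(m + k / 2) * (m - k / 2)| ≤ (10 ^ 6 * M) * (12 * N) := by
    rw [abs_mul]
    gcongr
    rw [abs_le] at *
    constructor <;> linarith
  have hν2 : |ν * ν| ≤ (2 ^ 14 * M) * (8 * N) := by
    rw [abs_mul]
    gcongr
  have hζ2 : |(ζ - k / 2) * (ζ + k / 2)| ≤ (10 ^ 7 * M) * N := by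
    have e : (ζ - k / 2) * (ζ + k / 2) = ν * ν - ((m + k / 2) * (m - k / 2)
        + ((3 * ν ^ 2 + k ^ 2) - (3 * ζ ^ 2 + m ^ 2))) / 3 := by
      ring
    rw [e]
    rw [abs_le] at hm2 hν2 e12 ⊢
    constructor <;> linarith [mul_pos hM hN]
  refine ⟨hm, hn, ?_⟩
  have hsum : |k| ≤ |ζ - k / 2| + |ζ + k / 2| := by
    have := abs_sub (ζ + k / 2) (ζ - k / 2)
    rw [show ζ + k / 2 - (ζ - k / 2) = k by ring] at this
    linarith
  rcases le_total (N / 4) |ζ - k / 2| with h | h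
  · have hζ : |ζ + k / 2| ≤ 10 ^ 8 * M :=
      (abs_le_of_abs_mul_le hN (d := 1 / 4) (by norm_num) (by linarith) hζ2).trans (by linarith)
    refine Or.inl ⟨hζ, ?_⟩
    rw [abs_le] at hζ hs ⊢
    constructor <;> linarith
  · have hζ : |ζ - k / 2| ≤ 10 ^ 8 * M := by
      rw [mul_comm] at hζ2
      exact (abs_le_of_abs_mul_le hN (d := 1 / 4) (by norm_num) (by linarith) hζ2).trans
        (by linarith)
    refine Or.inr ⟨?_, hζ⟩
    rw [abs_le] at hζ hs ⊢
    constructor <;> linarith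

/-- `(ν, k)`, `(ζ, m)`, `(ξ, n)` is `R`-close to `(0, k)`, `(-k/2, -k/2)`, `(k/2, -k/2)`. -/
def NearTriangle (R : ℝ) (p q r : ℝ × ℝ) : Prop :=
  |p.1| ≤ R ∧ nrm (q.1 - (-p.2 / 2)) (q.2 - (-p.2 / 2)) ≤ R ∧
    nrm (r.1 - (p.2 / 2)) (r.2 - (-p.2 / 2)) ≤ R

lemma nearTriangle_or_of_small_fst {N M ν ζ ξ k m n : ℝ} (hN : 0 < N) (hM : 0 < M)
    (hν : ν + ζ + ξ = 0) (hk : k + m + n = 0)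
    (h1 : N ≤ nrm ν k) (h1' : nrm ν k ≤ 8 * N) (h2' : nrm ζ m ≤ 8 * N) (h3' : nrm ξ n ≤ 8 * N)
    (h12 : |theta ν k - theta ζ m| ≤ 2 * M) (h23 : |theta ζ m - theta ξ n| ≤ 2 * M)
    (hs : |ν| ≤ 2 ^ 14 * M) :
    NearTriangle (10 ^ 9 * M) (ν, k) (ζ, m) (ξ, n) ∨
      NearTriangle (10 ^ 9 * M) (ν, k) (ξ, n) (ζ, m) := by
  have key {a b : ℝ} (ha : |a| ≤ 10 ^ 8 * M + 2 ^ 14 * M) (hb : |b| ≤ 10 ^ 6 * M) :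
      nrm a b ≤ 10 ^ 9 * M :=
    (nrm_le_abs_add_abs a b).trans (by linarith)
  simp only [NearTriangle, neg_div, sub_neg_eq_add]
  have hν' : |ν| ≤ 10 ^ 9 * M := by linarith
  rcases le_total (2 ^ 15 * M) N with hNM | hNM
  · obtain ⟨hm, hn, ⟨hζ, hξ⟩ | ⟨hξ, hζ⟩⟩ :=
      localization_of_small_fst hN hM hNM hν hk h1 h1' h2' h3' h12 h23 hs
    · exact Or.inl ⟨hν', key (by linarith) hm, key hξ hn⟩
    · exact Or.inr ⟨hν', key hξ hn, key (by linarith) hm⟩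
  · have hka := abs_le.mp ((abs_snd_le_nrm ν k).trans h1')
    have hζa := abs_le.mp ((abs_fst_le_nrm ζ m).trans h2')
    have hma := abs_le.mp ((abs_snd_le_nrm ζ m).trans h2')
    have hξa := abs_le.mp ((abs_fst_le_nrm ξ n).trans h3')
    have hna := abs_le.mp ((abs_snd_le_nrm ξ n).trans h3')
    have crude {a b : ℝ} (ha : |a| ≤ 12 * N) (hb : |b| ≤ 12 * N) : nrm a b ≤ 10 ^ 9 * M :=
      (nrm_le_abs_add_abs a b).trans (by linarith)
    refine Or.inl ⟨hν', crude ?_ ?_, crude ?_ ?_⟩ <;> rw [abs_le] <;> constructor <;> linarith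

/-- Near-resonant frequency triples are `O(M)`-close to a triangle configuration
`(0, k)`, `(-k/2, -k/2)`, `(k/2, -k/2)`, up to permutation of the three pairs. -/
theorem ZK_triangle_localization :
    ∃ C' : ℝ, 0 < C' ∧
      ∀ N M : ℝ, 0 < N → 0 < M → M ≤ N / 4000 →
      ∀ (ν ζ ξ : ℝ) (k m n : ℤ),
        ν + ζ + ξ = 0 → k + m + n = 0 →
        (N ≤ nrm ν (k : ℝ) ∧ nrm ν (k : ℝ) ≤ 8 * N) →
        (N ≤ nrm ζ (m : ℝ) ∧ nrm ζ (m : ℝ) ≤ 8 * N) →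
        (N ≤ nrm ξ (n : ℝ) ∧ nrm ξ (n : ℝ) ≤ 8 * N) →
        |theta ν (k : ℝ) - theta ζ (m : ℝ)| ≤ 2 * M →
        |theta ν (k : ℝ) - theta ξ (n : ℝ)| ≤ 2 * M →
        |theta ζ (m : ℝ) - theta ξ (n : ℝ)| ≤ 2 * M →
        min (min |ν| |ζ|) |ξ| ≤ 2 ^ 14 * M →
        ∃ σ : Equiv.Perm (Fin 3),
          |(![(ν, (k : ℝ)), (ζ, (m : ℝ)), (ξ, (n : ℝ))] (σ 0)).1| ≤ C' * M ∧
          nrm ((![(ν, (k : ℝ)), (ζ, (m : ℝ)), (ξ, (n : ℝ))] (σ 1)).1 -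
                (-(![(ν, (k : ℝ)), (ζ, (m : ℝ)), (ξ, (n : ℝ))] (σ 0)).2 / 2))
              ((![(ν, (k : ℝ)), (ζ, (m : ℝ)), (ξ, (n : ℝ))] (σ 1)).2 -
                (-(![(ν, (k : ℝ)), (ζ, (m : ℝ)), (ξ, (n : ℝ))] (σ 0)).2 / 2)) ≤ C' * M ∧
          nrm ((![(ν, (k : ℝ)), (ζ, (m : ℝ)), (ξ, (n : ℝ))] (σ 2)).1 -
                ((![(ν, (k : ℝ)), (ζ, (m : ℝ)), (ξ, (n : ℝ))] (σ 0)).2 / 2))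
              ((![(ν, (k : ℝ)), (ζ, (m : ℝ)), (ξ, (n : ℝ))] (σ 2)).2 -
                (-(![(ν, (k : ℝ)), (ζ, (m : ℝ)), (ξ, (n : ℝ))] (σ 0)).2 / 2)) ≤ C' * M := by
  refine ⟨10 ^ 9, by norm_num, ?_⟩
  intro N M hN hM _ ν ζ ξ k m n hν hk ⟨h1, h1'⟩ ⟨h2, h2'⟩ ⟨h3, h3'⟩ h12 h13 h23 hmin
  have hk' : (k : ℝ) + m + n = 0 := by exact_mod_cast hk
  have perm : ∀ i j l : Fin 3, i ≠ j → j ≠ l → i ≠ l →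
      ∃ σ : Equiv.Perm (Fin 3), σ 0 = i ∧ σ 1 = j ∧ σ 2 = l := by decide
  have close (i j l : Fin 3) (hij : i ≠ j) (hjl : j ≠ l) (hil : i ≠ l)
      (h : NearTriangle (10 ^ 9 * M) (![(ν, (k : ℝ)), (ζ, (m : ℝ)), (ξ, (n : ℝ))] i)
        (![(ν, (k : ℝ)), (ζ, (m : ℝ)), (ξ, (n : ℝ))] j)
        (![(ν, (k : ℝ)), (ζ, (m : ℝ)), (ξ, (n : ℝ))] l)) :
      ∃ σ : Equiv.Perm (Fin 3), NearTriangle (10 ^ 9 * M)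
        (![(ν, (k : ℝ)), (ζ, (m : ℝ)), (ξ, (n : ℝ))] (σ 0))
        (![(ν, (k : ℝ)), (ζ, (m : ℝ)), (ξ, (n : ℝ))] (σ 1))
        (![(ν, (k : ℝ)), (ζ, (m : ℝ)), (ξ, (n : ℝ))] (σ 2)) := by
    obtain ⟨σ, rfl, rfl, rfl⟩ := perm i j l hij hjl hil
    exact ⟨σ, h⟩
  rcases min_le_iff.mp hmin with h | hs
  · rcases min_le_iff.mp h with hs | hs
    · rcases nearTriangle_or_of_small_fst hN hM hν hk' h1 h1' h2' h3' h12 h23 hs with h | h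
      · exact close 0 1 2 (by decide) (by decide) (by decide) h
      · exact close 0 2 1 (by decide) (by decide) (by decide) h
    · rcases nearTriangle_or_of_small_fst hN hM (by linarith) (by linarith) h2 h2' h1' h3'
        (by rwa [abs_sub_comm]) h13 hs with h | h
      · exact close 1 0 2 (by decide) (by decide) (by decide) h
      · exact close 1 2 0 (by decide) (by decide) (by decide) h
  · rcases nearTriangle_or_of_small_fst hN hM (by linarith) (by linarith) h3 h3' h1' h2'
      (by rwa [abs_sub_comm]) h12 hs with h | h
    · exact close 2 0 1 (by decide) (by decide) (by decide) h
    · exact close 2 1 0 (by decide) (by decide) (by decide) h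


end
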